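/- Let X be a finite set with a weight function w : X → ℝ≥0, extended to subsets by w(A) = Σ_{x∈A} w(x), let 𝒮 be a nonempty finite family of subsets of X, and let k ≥ 1 be an integer. Let OPT = max{ w(A₁ ∪ … ∪ A_k) : A₁,…,A_k ∈ 𝒮 }, and let T₁,…,T_k ∈ 𝒮 be a greedy sequence (each T_{i+1} maximizes w(A ∖ (T₁ ∪ … ∪ T_i)) over A ∈ 𝒮). Write C_i = T₁ ∪ … ∪ T_i (with C_0 = ∅). Then for every 0 ≤ i < k, OPT − w(C_{i+1}) ≤ (1 − 1/k)·(OPT − w(C_i)). -/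

import Mathlib

open Finset

/-- The union of the first `i` sets chosen by the greedy algorithm
(`T j` for indices `j` with `(j : ℕ) < i`); this is `C_i`, with `C_0 = ∅`. -/
def prefixUnion {α : Type*} [DecidableEq α] {k : ℕ} (T : Fin k → Finset α) (i : ℕ) :
    Finset α :=
  (Finset.univ.filter (fun j : Fin k => (j : ℕ) < i)).biUnion T

/-- Passing from the first `i` sets to the first `i + 1` sets adjoins the set of index `i`. -/
theorem prefixUnion_succ {α : Type*} [DecidableEq α] {k : ℕ} (T : Fin k → Finset α)
    (i : Fin k) : prefixUnion T ((i : ℕ) + 1) = prefixUnion T i ∪ T i := by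
  ext x
  simp only [prefixUnion, mem_biUnion, mem_filter, mem_univ, true_and, mem_union,
    Nat.lt_succ_iff_lt_or_eq, or_and_right, exists_or, Fin.val_inj, exists_eq_left]

/-- Subadditivity of a nonnegative weight over a finite union of sets. -/
theorem sum_biUnion_le_sum_sum {ι α : Type*} [DecidableEq α] (s : Finset ι)
    (A : ι → Finset α) (f : α → ℝ) (hf : ∀ x, 0 ≤ f x) :
    ∑ x ∈ s.biUnion A, f x ≤ ∑ j ∈ s, ∑ x ∈ A j, f x := by
  classical
  induction s using Finset.induction_on with
  | empty => simp
  | insert a s ha ih =>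
    rw [biUnion_insert, sum_insert ha]
    have h := sum_union_inter (s₁ := A a) (s₂ := s.biUnion A) (f := f)
    have h' : 0 ≤ ∑ x ∈ A a ∩ s.biUnion A, f x := sum_nonneg fun x _ => hf x
    linarith

/-- **Per-iteration contraction of the greedy algorithm for Weighted Maximum
Coverage.**  Let `X` be a finite universe with nonnegative weights `w`, `𝒮` a
nonempty family of subsets, `k ≥ 1`, and let `OPT` be the maximum weight of the
union of `k` sets from `𝒮`.  If `T 0, …, T (k-1) ∈ 𝒮` is a greedy sequence and
`C i` denotes the union of the first `i` greedy sets, then for every `0 ≤ i < k`,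
`OPT − w (C (i+1)) ≤ (1 − 1/k) · (OPT − w (C i))`. -/
theorem greedy_wmcp_contraction
    {α : Type*} [DecidableEq α] (w : α → NNReal)
    (𝒮 : Finset (Finset α)) (h𝒮 : 𝒮.Nonempty)
    (k : ℕ) (hk : 1 ≤ k)
    (OPT : ℝ)
    (hOPT_mem : ∃ A : Fin k → Finset α, (∀ i, A i ∈ 𝒮) ∧
      OPT = ∑ x ∈ Finset.univ.biUnion A, (w x : ℝ))
    (hOPT_max : ∀ A : Fin k → Finset α, (∀ i, A i ∈ 𝒮) →
      ∑ x ∈ Finset.univ.biUnion A, (w x : ℝ) ≤ OPT)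
    (T : Fin k → Finset α) (hT : ∀ i, T i ∈ 𝒮)
    (hgreedy : ∀ i : Fin k, ∀ A ∈ 𝒮,
      ∑ x ∈ A \ prefixUnion T (i : ℕ), (w x : ℝ) ≤
        ∑ x ∈ T i \ prefixUnion T (i : ℕ), (w x : ℝ)) :
    ∀ i : ℕ, i < k →
      OPT - ∑ x ∈ prefixUnion T (i + 1), (w x : ℝ) ≤
        (1 - 1 / (k : ℝ)) * (OPT - ∑ x ∈ prefixUnion T i, (w x : ℝ)) := by
  intro i hi
  obtain ⟨A, hA, hOPT⟩ := hOPT_mem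
  set C := prefixUnion T i
  set g : ℝ := ∑ x ∈ T ⟨i, hi⟩ \ C, (w x : ℝ)
  have hsucc : ∑ x ∈ prefixUnion T (i + 1), (w x : ℝ) = ∑ x ∈ C, (w x : ℝ) + g := by
    rw [prefixUnion_succ T ⟨i, hi⟩, ← union_sdiff_self_eq_union, sum_union disjoint_sdiff]
  have hgap : OPT ≤ ∑ x ∈ C, (w x : ℝ) + k * g := by
    calc OPT = ∑ x ∈ univ.biUnion A, (w x : ℝ) := hOPT
      _ ≤ ∑ x ∈ C ∪ univ.biUnion (fun j => A j \ C), (w x : ℝ) := by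
        refine sum_le_sum_of_subset_of_nonneg (fun x hx => ?_) fun x _ _ => (w x).coe_nonneg
        simp only [mem_biUnion, mem_univ, true_and, mem_union, mem_sdiff] at hx ⊢
        grind
      _ = ∑ x ∈ C, (w x : ℝ) + ∑ x ∈ univ.biUnion (fun j => A j \ C), (w x : ℝ) :=
        sum_union (disjoint_biUnion_right _ _ _ |>.2 fun _ _ => disjoint_sdiff)
      _ ≤ ∑ x ∈ C, (w x : ℝ) + ∑ j, ∑ x ∈ A j \ C, (w x : ℝ) := by
        gcongr
        exact sum_biUnion_le_sum_sum _ _ _ fun x => (w x).coe_nonneg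
      _ ≤ ∑ x ∈ C, (w x : ℝ) + ∑ _j : Fin k, g := by
        gcongr with j
        exact hgreedy ⟨i, hi⟩ (A j) (hA j)
      _ = ∑ x ∈ C, (w x : ℝ) + k * g := by simp
  have hk0 : (0 : ℝ) < k := by exact_mod_cast hk
  have hdiv : (OPT - ∑ x ∈ C, (w x : ℝ)) / k ≤ g := by
    rw [div_le_iff₀ hk0]
    linarith
  rw [hsucc, one_sub_mul, one_div_mul_eq_div]
  linarith
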